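/- Let n ≥ 1, p ≥ 2, and let Π⁺ = {(x, y, t) ∈ ℝⁿ × ℝⁿ × ℝ : x₁ > 0} (the half-space Π⁺_{ν,d} with ν = (1, 0, …, 0) and d = 0). The constant ((p−1)/p)^p in the L^p Hardy inequality of Theorem 2 is sharp for this half-space: for every ε > 0 there exists a nonzero u ∈ C_0^∞(Π⁺) such that ∫_{Π⁺} |∇_{ℍⁿ} u|^p dξ < (((p−1)/p)^p + ε) ∫_{Π⁺} (|u|^p / x₁^p) dξ. (Note that for this ν, Σ_{i=1}^n (|⟨X_i(ξ), ν⟩|^p + |⟨Y_i(ξ), ν⟩|^p) = 1 and dist(ξ, ∂Π⁺) = x₁.) -/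

import Mathlib

open MeasureTheory RealInnerProductSpace

noncomputable section

/-- The Heisenberg group `ℍⁿ`, identified with Euclidean `ℝ^{2n+1}`;
coordinates `0,…,n-1` are `x`, `n,…,2n-1` are `y`, and `2n` is `t`. -/
abbrev Heis (n : ℕ) := EuclideanSpace ℝ (Fin (2 * n + 1))

/-- Index of the coordinate `x_i`. -/
def xIdx {n : ℕ} (i : Fin n) : Fin (2 * n + 1) := ⟨i.1, by have := i.2; omega⟩

/-- Index of the coordinate `y_i`. -/
def yIdx {n : ℕ} (i : Fin n) : Fin (2 * n + 1) := ⟨n + i.1, by have := i.2; omega⟩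

/-- Index of the coordinate `t`. -/
def tIdx (n : ℕ) : Fin (2 * n + 1) := ⟨2 * n, by omega⟩

/-- The horizontal vector field `X_i = ∂/∂x_i + 2 y_i ∂/∂t` acting on a function. -/
def Xd {n : ℕ} (i : Fin n) (u : Heis n → ℝ) (ξ : Heis n) : ℝ :=
  fderiv ℝ u ξ (EuclideanSpace.single (xIdx i) 1)
    + 2 * ξ (yIdx i) * fderiv ℝ u ξ (EuclideanSpace.single (tIdx n) 1)

/-- The horizontal vector field `Y_i = ∂/∂y_i − 2 x_i ∂/∂t` acting on a function. -/
def Yd {n : ℕ} (i : Fin n) (u : Heis n → ℝ) (ξ : Heis n) : ℝ :=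
  fderiv ℝ u ξ (EuclideanSpace.single (yIdx i) 1)
    - 2 * ξ (xIdx i) * fderiv ℝ u ξ (EuclideanSpace.single (tIdx n) 1)

/-- `|∇_{ℍⁿ} u|² = Σ_i (X_i u)² + (Y_i u)²`. -/
def gradH2 {n : ℕ} (u : Heis n → ℝ) (ξ : Heis n) : ℝ :=
  ∑ i : Fin n, ((Xd i u ξ) ^ 2 + (Yd i u ξ) ^ 2)

/-- `⟨X_i(ξ), ν⟩ = ν_{x_i} + 2 y_i ν_t`. -/
def XiNu {n : ℕ} (i : Fin n) (ξ ν : Heis n) : ℝ := ν (xIdx i) + 2 * ξ (yIdx i) * ν (tIdx n)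

/-- `⟨Y_i(ξ), ν⟩ = ν_{y_i} − 2 x_i ν_t`. -/
def YiNu {n : ℕ} (i : Fin n) (ξ ν : Heis n) : ℝ := ν (yIdx i) - 2 * ξ (xIdx i) * ν (tIdx n)

lemma measurableSet_coord_pos {ι : Type*} [Fintype ι] (k : ι) :
    MeasurableSet {ξ : EuclideanSpace ℝ ι | 0 < ξ k} :=
  (EuclideanSpace.proj k : EuclideanSpace ℝ ι →L[ℝ] ℝ).continuous.measurable measurableSet_Ioi

section ProductIntegrals

variable {ι : Type*} [Fintype ι] [DecidableEq ι]

lemma mul_prod_erase_eq_prod_update (k : ι) (h g : ℝ → ℝ) (ξ : ι → ℝ) :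
    h (ξ k) * ∏ i ∈ Finset.univ.erase k, g (ξ i) =
      ∏ i, (Function.update (fun _ => g) k h i) (ξ i) := by
  rw [← Finset.mul_prod_erase Finset.univ _ (Finset.mem_univ k), Function.update_self]
  congr 1
  refine Finset.prod_congr rfl fun i hi => ?_
  rw [Function.update_of_ne (Finset.ne_of_mem_erase hi)]

lemma integrable_mul_prod_erase (k : ι) {h g : ℝ → ℝ} (hh : Integrable h) (hg : Integrable g) :
    Integrable fun ξ : EuclideanSpace ℝ ι =>
      h (ξ k) * ∏ i ∈ Finset.univ.erase k, g (ξ i) := by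
  rw [← (PiLp.volume_preserving_toLp ι).integrable_comp_emb
    (MeasurableEquiv.toLp 2 (ι → ℝ)).measurableEmbedding]
  simp only [Function.comp_def, mul_prod_erase_eq_prod_update k h g]
  refine Integrable.fintype_prod_dep fun i => ?_
  by_cases hi : i = k
  · subst hi; simpa using hh
  · simpa [Function.update_of_ne hi] using hg

lemma integral_mul_prod_erase (k : ι) (h g : ℝ → ℝ) :
    ∫ ξ : EuclideanSpace ℝ ι, h (ξ k) * ∏ i ∈ Finset.univ.erase k, g (ξ i) =
      (∫ x, h x) * (∫ x, g x) ^ (Fintype.card ι - 1) := by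
  rw [← (PiLp.volume_preserving_toLp ι).integral_comp
    (MeasurableEquiv.toLp 2 (ι → ℝ)).measurableEmbedding]
  simp only [mul_prod_erase_eq_prod_update k h g]
  rw [integral_fintype_prod_volume_eq_prod,
    ← Finset.mul_prod_erase Finset.univ _ (Finset.mem_univ k), Function.update_self]
  congr 1
  rw [← Finset.card_univ, ← Finset.card_erase_of_mem (Finset.mem_univ k), ← Finset.prod_const]
  refine Finset.prod_congr rfl fun i hi => ?_
  rw [Function.update_of_ne (Finset.ne_of_mem_erase hi)]

lemma indicator_coord_pos_mul_prod_erase (k : ι) (h g : ℝ → ℝ) :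
    ({ξ : EuclideanSpace ℝ ι | 0 < ξ k}.indicator
      fun ξ => h (ξ k) * ∏ i ∈ Finset.univ.erase k, g (ξ i)) =
      fun ξ => (Set.Ioi 0).indicator h (ξ k) * ∏ i ∈ Finset.univ.erase k, g (ξ i) := by
  ext ξ
  by_cases hξ : 0 < ξ k <;> simp [Set.indicator, hξ]

lemma integrableOn_mul_prod_erase (k : ι) {h g : ℝ → ℝ}
    (hh : IntegrableOn h (Set.Ioi 0)) (hg : Integrable g) :
    IntegrableOn (fun ξ : EuclideanSpace ℝ ι => h (ξ k) * ∏ i ∈ Finset.univ.erase k, g (ξ i))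
      {ξ | 0 < ξ k} := by
  rw [← integrable_indicator_iff (measurableSet_coord_pos k), indicator_coord_pos_mul_prod_erase]
  exact integrable_mul_prod_erase k ((integrable_indicator_iff measurableSet_Ioi).2 hh) hg

lemma setIntegral_mul_prod_erase (k : ι) (h g : ℝ → ℝ) :
    ∫ ξ in {ξ : EuclideanSpace ℝ ι | 0 < ξ k}, h (ξ k) * ∏ i ∈ Finset.univ.erase k, g (ξ i) =
      (∫ x in Set.Ioi 0, h x) * (∫ x, g x) ^ (Fintype.card ι - 1) := by
  rw [← integral_indicator (measurableSet_coord_pos k), indicator_coord_pos_mul_prod_erase,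
    integral_mul_prod_erase, integral_indicator measurableSet_Ioi]

end ProductIntegrals

section LogSubstitution

lemma image_exp_div_univ {s : ℝ} (hs : 0 < s) :
    (fun τ : ℝ => Real.exp (τ / s)) '' Set.univ = Set.Ioi 0 := by
  ext x
  simp only [Set.image_univ, Set.mem_range, Set.mem_Ioi]
  refine ⟨fun ⟨τ, h⟩ => h ▸ Real.exp_pos _, fun h => ⟨s * Real.log x, ?_⟩⟩
  rw [mul_div_cancel_left₀ _ hs.ne', Real.exp_log h]

lemma hasDerivAt_exp_div (s τ : ℝ) :
    HasDerivAt (fun τ : ℝ => Real.exp (τ / s)) (Real.exp (τ / s) * (1 / s)) τ :=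
  ((hasDerivAt_id τ).div_const s).exp

lemma injOn_exp_div {s : ℝ} (hs : 0 < s) :
    Set.InjOn (fun τ : ℝ => Real.exp (τ / s)) Set.univ := fun a _ b _ h => by
  have := Real.exp_injective h
  field_simp at this
  exact this

lemma abs_deriv_exp_div_smul {s : ℝ} (hs : 0 < s) (h : ℝ → ℝ) (τ : ℝ) :
    |Real.exp (τ / s) * (1 / s)| • ((Real.exp (τ / s))⁻¹ * h (s * Real.log (Real.exp (τ / s)))) =
      1 / s * h τ := by
  rw [abs_of_pos (by positivity), Real.log_exp, mul_div_cancel₀ _ hs.ne', smul_eq_mul]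
  field_simp

lemma integrableOn_Ioi_inv_mul_comp_log {s : ℝ} (hs : 0 < s) {h : ℝ → ℝ} (hh : Integrable h) :
    IntegrableOn (fun x => x⁻¹ * h (s * Real.log x)) (Set.Ioi 0) := by
  rw [← image_exp_div_univ hs, integrableOn_image_iff_integrableOn_abs_deriv_smul
    MeasurableSet.univ (fun τ _ => (hasDerivAt_exp_div s τ).hasDerivWithinAt) (injOn_exp_div hs)]
  simp only [abs_deriv_exp_div_smul hs h, integrableOn_univ]
  exact hh.const_mul _

lemma integral_Ioi_inv_mul_comp_log {s : ℝ} (hs : 0 < s) (h : ℝ → ℝ) :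
    ∫ x in Set.Ioi 0, x⁻¹ * h (s * Real.log x) = 1 / s * ∫ τ, h τ := by
  rw [← image_exp_div_univ hs, integral_image_eq_integral_abs_deriv_smul
    MeasurableSet.univ (fun τ _ => (hasDerivAt_exp_div s τ).hasDerivWithinAt) (injOn_exp_div hs)]
  simp only [abs_deriv_exp_div_smul hs h, Measure.restrict_univ, integral_const_mul]

end LogSubstitution

/-- A form of the convexity of `x ↦ x ^ p` which isolates the first summand. -/
lemma add_rpow_le_weighted {p θ a b : ℝ} (hp : 1 ≤ p) (hθ : 0 < θ) (hθ' : θ < 1)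
    (ha : 0 ≤ a) (hb : 0 ≤ b) :
    (a + b) ^ p ≤ (1 - θ) ^ (1 - p) * a ^ p + θ ^ (1 - p) * b ^ p := by
  have h1 : 0 < 1 - θ := by linarith
  have key := (convexOn_rpow hp).2 (x := a / (1 - θ)) (y := b / θ)
    (Set.mem_Ici.2 (by positivity)) (Set.mem_Ici.2 (by positivity)) h1.le hθ.le (by ring)
  simp only [smul_eq_mul] at key
  rw [mul_div_cancel₀ _ h1.ne', mul_div_cancel₀ _ hθ.ne', Real.div_rpow ha h1.le,
    Real.div_rpow hb hθ.le] at key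
  rw [Real.rpow_sub h1, Real.rpow_sub hθ, Real.rpow_one, Real.rpow_one]
  calc _ ≤ _ := key
    _ = _ := by ring

lemma xIdx_injective {n : ℕ} : Function.Injective (xIdx (n := n)) := fun i j h => by
  simpa [xIdx, Fin.ext_iff] using h

lemma yIdx_ne_xIdx {n : ℕ} (i j : Fin n) : yIdx i ≠ xIdx j := by
  have := j.2
  simp only [xIdx, yIdx, ne_eq, Fin.ext_iff]
  omega

lemma tIdx_ne_xIdx {n : ℕ} (j : Fin n) : tIdx n ≠ xIdx j := by
  have := j.2
  simp only [xIdx, tIdx, ne_eq, Fin.ext_iff]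
  omega

section Gradient

variable {n : ℕ} {f : ℝ → ℝ} {φ : Heis n → ℝ} {ξ : Heis n}

lemma fderiv_comp_coord_mul {j : Fin (2 * n + 1)} (hf : DifferentiableAt ℝ f (ξ j))
    (hφ : DifferentiableAt ℝ φ ξ) (v : Heis n) :
    fderiv ℝ (fun ζ : Heis n => f (ζ j) * φ ζ) ξ v =
      f (ξ j) * fderiv ℝ φ ξ v + φ ξ * (deriv f (ξ j) * v j) := by
  have h1 : HasFDerivAt (fun ζ : Heis n => ζ j) (EuclideanSpace.proj j : Heis n →L[ℝ] ℝ) ξ :=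
    (EuclideanSpace.proj j : Heis n →L[ℝ] ℝ).hasFDerivAt
  have h2 : HasFDerivAt (fun ζ : Heis n => f (ζ j)) _ ξ :=
    HasDerivAt.comp_hasFDerivAt ξ hf.hasDerivAt h1
  have h3 : HasFDerivAt (fun ζ : Heis n => f (ζ j) * φ ζ) _ ξ := h2.mul hφ.hasFDerivAt
  rw [h3.fderiv]
  simp

lemma Xd_comp_coord_mul {k : Fin n} (hf : DifferentiableAt ℝ f (ξ (xIdx k)))
    (hφ : DifferentiableAt ℝ φ ξ) (i : Fin n) :
    Xd i (fun ζ : Heis n => f (ζ (xIdx k)) * φ ζ) ξ =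
      f (ξ (xIdx k)) * Xd i φ ξ + if i = k then deriv f (ξ (xIdx k)) * φ ξ else 0 := by
  simp only [Xd, fderiv_comp_coord_mul hf hφ, PiLp.single_apply,
    (tIdx_ne_xIdx k).symm, xIdx_injective.eq_iff, if_false, eq_comm (a := k)]
  split_ifs <;> ring

lemma Yd_comp_coord_mul {k : Fin n} (hf : DifferentiableAt ℝ f (ξ (xIdx k)))
    (hφ : DifferentiableAt ℝ φ ξ) (i : Fin n) :
    Yd i (fun ζ : Heis n => f (ζ (xIdx k)) * φ ζ) ξ = f (ξ (xIdx k)) * Yd i φ ξ := by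
  simp only [Yd, fderiv_comp_coord_mul hf hφ, PiLp.single_apply,
    (tIdx_ne_xIdx k).symm, (yIdx_ne_xIdx i k).symm, if_false]
  ring

lemma gradH2_nonneg (u : Heis n → ℝ) (ξ : Heis n) : 0 ≤ gradH2 u ξ :=
  Finset.sum_nonneg fun _ _ => by positivity

lemma Xd_sq_le_gradH2 (i : Fin n) (u : Heis n → ℝ) (ξ : Heis n) : Xd i u ξ ^ 2 ≤ gradH2 u ξ :=
  calc Xd i u ξ ^ 2 ≤ Xd i u ξ ^ 2 + Yd i u ξ ^ 2 := le_add_of_nonneg_right (sq_nonneg _)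
    _ ≤ gradH2 u ξ := Finset.single_le_sum (f := fun i => Xd i u ξ ^ 2 + Yd i u ξ ^ 2)
        (fun _ _ => by positivity) (Finset.mem_univ i)

lemma sqrt_gradH2_comp_coord_mul_le {k : Fin n} (hf : DifferentiableAt ℝ f (ξ (xIdx k)))
    (hφ : DifferentiableAt ℝ φ ξ) :
    √(gradH2 (fun ζ : Heis n => f (ζ (xIdx k)) * φ ζ) ξ) ≤
      |deriv f (ξ (xIdx k))| * |φ ξ| + |f (ξ (xIdx k))| * √(gradH2 φ ξ) := by
  set F := f (ξ (xIdx k))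
  set A := deriv f (ξ (xIdx k)) * φ ξ with hA
  set S := √(gradH2 φ ξ)
  have hS : S ^ 2 = gradH2 φ ξ := Real.sq_sqrt (gradH2_nonneg _ _)
  have hX : |Xd k φ ξ| ≤ S := Real.abs_le_sqrt (Xd_sq_le_gradH2 k φ ξ)
  have key : gradH2 (fun ζ : Heis n => f (ζ (xIdx k)) * φ ζ) ξ =
      F ^ 2 * gradH2 φ ξ + (A ^ 2 + 2 * A * (F * Xd k φ ξ)) := by
    have : ∀ i, (Xd i (fun ζ : Heis n => f (ζ (xIdx k)) * φ ζ) ξ) ^ 2 +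
        (Yd i (fun ζ : Heis n => f (ζ (xIdx k)) * φ ζ) ξ) ^ 2 =
        F ^ 2 * (Xd i φ ξ ^ 2 + Yd i φ ξ ^ 2) +
          if i = k then A ^ 2 + 2 * A * (F * Xd i φ ξ) else 0 := fun i => by
      rw [Xd_comp_coord_mul hf hφ, Yd_comp_coord_mul hf hφ]
      split_ifs <;> ring
    simp only [gradH2, this, Finset.sum_add_distrib, ← Finset.mul_sum, Finset.sum_ite_eq',
      Finset.mem_univ, if_true]
  rw [← abs_mul, ← hA]
  rw [Real.sqrt_le_left (by positivity)]
  rw [key, ← hS]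
  have h1 : A * (F * Xd k φ ξ) ≤ |A| * (|F| * S) := by
    calc _ ≤ |A * (F * Xd k φ ξ)| := le_abs_self _
      _ = |A| * (|F| * |Xd k φ ξ|) := by rw [abs_mul A, abs_mul F]
      _ ≤ _ := by gcongr
  nlinarith [sq_abs A, sq_abs F]

lemma gradH2_eq_zero_of_eventuallyEq_zero (h : φ =ᶠ[nhds ξ] fun _ => 0) : gradH2 φ ξ = 0 := by
  simp [gradH2, Xd, Yd, h.fderiv_eq]

lemma continuous_gradH2 (hφ : ContDiff ℝ 1 φ) : Continuous (gradH2 φ) := by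
  have h : ∀ v, Continuous fun ζ => fderiv ℝ φ ζ v := fun v =>
    (hφ.continuous_fderiv one_ne_zero).clm_apply continuous_const
  unfold gradH2 Xd Yd
  have := h
  fun_prop

lemma exists_sqrt_gradH2_le (hφ : ContDiff ℝ 1 φ) (hc : HasCompactSupport φ) :
    ∃ M, 0 ≤ M ∧ ∀ ξ, √(gradH2 φ ξ) ≤ M := by
  obtain ⟨C, hC⟩ := hc.isCompact.exists_bound_of_continuousOn (continuous_gradH2 hφ).continuousOn
  refine ⟨√C, Real.sqrt_nonneg _, fun ξ => ?_⟩
  by_cases hξ : ξ ∈ tsupport φ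
  · exact Real.sqrt_le_sqrt ((le_abs_self _).trans (hC ξ hξ))
  · rw [gradH2_eq_zero_of_eventuallyEq_zero (notMem_tsupport_iff_eventuallyEq.1 hξ), Real.sqrt_zero]
    exact Real.sqrt_nonneg _

end Gradient

section Cutoff

variable {ι : Type*} [Fintype ι] {g : ℝ → ℝ}

lemma contDiff_prod_coord (hg : ContDiff ℝ (⊤ : ℕ∞) g) :
    ContDiff ℝ (⊤ : ℕ∞) fun ξ : EuclideanSpace ℝ ι => ∏ i, g (ξ i) :=
  contDiff_prod fun i _ => hg.comp (EuclideanSpace.proj i : EuclideanSpace ℝ ι →L[ℝ] ℝ).contDiff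

lemma hasCompactSupport_prod_coord (hg : HasCompactSupport g) :
    HasCompactSupport fun ξ : EuclideanSpace ℝ ι => ∏ i, g (ξ i) := by
  refine HasCompactSupport.intro ((EuclideanSpace.equiv ι ℝ).toHomeomorph.isCompact_preimage.2
    (isCompact_univ_pi fun _ => hg.isCompact)) fun ξ hξ => ?_
  obtain ⟨i, hi⟩ : ∃ i, ξ i ∉ tsupport g := by
    simpa [Set.mem_pi] using hξ
  exact Finset.prod_eq_zero (Finset.mem_univ i) (image_eq_zero_of_notMem_tsupport hi)

end Cutoff

/-- The function `x ↦ x ^ a * χ (s * log x)` on the positive half-line, extended by zero. -/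
def logProfile (a s : ℝ) (χ : ℝ → ℝ) (x : ℝ) : ℝ :=
  if 0 < x then x ^ a * χ (s * Real.log x) else 0

section LogProfile

variable {a s L : ℝ} {χ : ℝ → ℝ}

lemma logProfile_of_pos {x : ℝ} (hx : 0 < x) :
    logProfile a s χ x = x ^ a * χ (s * Real.log x) := if_pos hx

lemma mul_log_notMem_of_lt_exp (hs : 0 < s) {x : ℝ} (hx : 0 < x) (h : x < Real.exp (-2 / s)) :
    s * Real.log x ∉ Set.Icc (-2 : ℝ) (-1) := fun hm => by
  have h1 := (Real.log_lt_iff_lt_exp hx).2 h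
  rw [lt_div_iff₀ hs] at h1
  linarith [hm.1]

lemma logProfile_eq_zero_of_lt_exp (hs : 0 < s) (hχ : tsupport χ ⊆ Set.Icc (-2) (-1)) {x : ℝ}
    (h : x < Real.exp (-2 / s)) : logProfile a s χ x = 0 := by
  by_cases hx : 0 < x
  · rw [logProfile_of_pos hx, image_eq_zero_of_notMem_tsupport
      fun hm => mul_log_notMem_of_lt_exp hs hx h (hχ hm), mul_zero]
  · exact if_neg hx

lemma logProfile_eventuallyEq {x : ℝ} (hx : 0 < x) :
    logProfile a s χ =ᶠ[nhds x] fun y => y ^ a * χ (s * Real.log y) := by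
  filter_upwards [lt_mem_nhds hx] with y hy using logProfile_of_pos hy

lemma contDiff_logProfile (hs : 0 < s) (hχ : tsupport χ ⊆ Set.Icc (-2) (-1))
    (hχ' : ContDiff ℝ (⊤ : ℕ∞) χ) : ContDiff ℝ (⊤ : ℕ∞) (logProfile a s χ) := by
  rw [contDiff_iff_contDiffAt]
  intro x
  rcases lt_or_ge 0 x with hx | hx
  · refine ContDiffAt.congr_of_eventuallyEq ?_ (logProfile_eventuallyEq hx)
    exact (Real.contDiffAt_rpow_const_of_ne hx.ne').mul
      (hχ'.contDiffAt.comp x (contDiffAt_const.mul (Real.contDiffAt_log.2 hx.ne')))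
  · refine ContDiffAt.congr_of_eventuallyEq (contDiffAt_const (c := 0)) ?_
    filter_upwards [gt_mem_nhds (hx.trans_lt (Real.exp_pos (-2 / s)))] with y hy using
      logProfile_eq_zero_of_lt_exp hs hχ hy

lemma deriv_logProfile (hχ : Differentiable ℝ χ) {x : ℝ} (hx : 0 < x) :
    deriv (logProfile a s χ) x =
      x ^ (a - 1) * (a * χ (s * Real.log x) + s * deriv χ (s * Real.log x)) := by
  have h1 : HasDerivAt (fun y => χ (s * Real.log y)) (deriv χ (s * Real.log x) * (s * x⁻¹)) x :=
    (hχ _).hasDerivAt.comp x ((Real.hasDerivAt_log hx.ne').const_mul s)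
  rw [(logProfile_eventuallyEq hx).deriv_eq,
    ((Real.hasDerivAt_rpow_const (Or.inl hx.ne')).fun_mul h1).deriv, Real.rpow_sub_one hx.ne']
  field_simp

lemma abs_deriv_logProfile_le (ha : 0 ≤ a) (hs : 0 < s) (hχ : tsupport χ ⊆ Set.Icc (-2) (-1))
    (hχ' : Differentiable ℝ χ) (hL : ∀ τ, |deriv χ τ| ≤ L) {x : ℝ} (hx : 0 < x) :
    |deriv (logProfile a s χ) x| ≤ x ^ (a - 1) * (a * |χ (s * Real.log x)| +
      s * L * (Set.Icc (-2 : ℝ) (-1)).indicator 1 (s * Real.log x)) := by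
  have h1 : |deriv χ (s * Real.log x)| ≤
      L * (Set.Icc (-2 : ℝ) (-1)).indicator 1 (s * Real.log x) := by
    by_cases hm : s * Real.log x ∈ Set.Icc (-2 : ℝ) (-1)
    · simpa [hm] using hL _
    · have : deriv χ (s * Real.log x) = 0 := by
        by_contra h
        exact hm (hχ (support_deriv_subset h))
      simp [hm, this]
  rw [deriv_logProfile hχ' hx, abs_mul, abs_of_pos (Real.rpow_pos_of_pos hx _)]
  refine mul_le_mul_of_nonneg_left ((abs_add_le _ _).trans ?_) (Real.rpow_pos_of_pos hx _).le
  rw [abs_mul, abs_mul, abs_of_nonneg ha, abs_of_pos hs, mul_assoc]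
  gcongr

lemma le_of_mul_log_le_neg_one (hs : 0 < s) {x : ℝ} (hx : 0 < x) (h : s * Real.log x ≤ -1) :
    x ≤ s := by
  have h1 : 1 / s ≤ Real.log x⁻¹ := by
    rw [Real.log_inv, div_le_iff₀ hs]; linarith
  have h2 := h1.trans (Real.log_le_self (inv_pos.2 hx).le)
  rwa [one_div, inv_le_inv₀ hs hx] at h2

lemma abs_logProfile_le (hs : 0 < s) (hχ : tsupport χ ⊆ Set.Icc (-2) (-1))
    (hχ1 : ∀ τ, |χ τ| ≤ 1) {x : ℝ} (hx : 0 < x) :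
    |logProfile a s χ x| ≤
      x ^ (a - 1) * (s * (Set.Icc (-2 : ℝ) (-1)).indicator 1 (s * Real.log x)) := by
  by_cases hm : s * Real.log x ∈ Set.Icc (-2 : ℝ) (-1)
  · have h1 : x ^ a = x ^ (a - 1) * x := by
      rw [Real.rpow_sub_one hx.ne', div_mul_cancel₀ _ hx.ne']
    have h2 := (Real.rpow_pos_of_pos hx (a - 1)).le
    rw [logProfile_of_pos hx, h1, abs_mul, abs_mul, abs_of_nonneg h2, abs_of_pos hx, mul_assoc]
    simp only [Set.indicator_of_mem hm, Pi.one_apply]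
    have h3 := le_of_mul_log_le_neg_one hs hx hm.2
    gcongr
    exact hχ1 _
  · rw [logProfile_of_pos hx, image_eq_zero_of_notMem_tsupport fun h => hm (hχ h)]
    simp [hm]

end LogProfile

section TestFunction

variable {n : ℕ} {a s L M : ℝ} {χ g : ℝ → ℝ} {k : Fin n}

lemma sqrt_gradH2_logProfile_mul_prod_le (ha : 0 ≤ a) (hs : 0 < s)
    (hχ : ContDiff ℝ (⊤ : ℕ∞) χ) (hχs : tsupport χ ⊆ Set.Icc (-2) (-1))
    (hχ0 : ∀ τ, 0 ≤ χ τ) (hχ1 : ∀ τ, χ τ ≤ 1) (hL : ∀ τ, |deriv χ τ| ≤ L)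
    (hg : ContDiff ℝ (⊤ : ℕ∞) g) (hgs : tsupport g ⊆ Set.Icc (-2) 2)
    (hg0 : ∀ x, 0 ≤ g x) (hg1 : ∀ x, g x ≤ 1)
    (hM : ∀ ξ : Heis n, √(gradH2 (fun ζ : Heis n => ∏ i, g (ζ i)) ξ) ≤ M)
    {ξ : Heis n} (hξ : 0 < ξ (xIdx k)) :
    √(gradH2 (fun ζ : Heis n => logProfile a s χ (ζ (xIdx k)) * ∏ i, g (ζ i)) ξ) ≤
      ξ (xIdx k) ^ (a - 1) *
        (a * χ (s * Real.log (ξ (xIdx k))) * ∏ i ∈ Finset.univ.erase (xIdx k), g (ξ i) +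
          s * (L + M) * ((Set.Icc (-2 : ℝ) (-1)).indicator 1 (s * Real.log (ξ (xIdx k))) *
            ∏ i ∈ Finset.univ.erase (xIdx k), (Set.Icc (-2 : ℝ) 2).indicator 1 (ξ i))) := by
  set x := ξ (xIdx k)
  set P := ∏ i ∈ Finset.univ.erase (xIdx k), g (ξ i)
  set J := (Set.Icc (-2 : ℝ) (-1)).indicator (1 : ℝ → ℝ) (s * Real.log x)
  have hJ : 0 ≤ J := Set.indicator_nonneg (fun _ _ => zero_le_one) _
  have hL0 : 0 ≤ L := (abs_nonneg _).trans (hL 0)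
  have hM0 : 0 ≤ M := (Real.sqrt_nonneg _).trans (hM 0)
  have hP0 : 0 ≤ P := Finset.prod_nonneg fun i _ => hg0 _
  have hx : 0 ≤ x ^ (a - 1) := (Real.rpow_pos_of_pos hξ _).le
  by_cases hQ : ∀ i ∈ Finset.univ.erase (xIdx k), ξ i ∈ Set.Icc (-2 : ℝ) 2
  · have hQ1 : ∏ i ∈ Finset.univ.erase (xIdx k), (Set.Icc (-2 : ℝ) 2).indicator
        (1 : ℝ → ℝ) (ξ i) = 1 :=
      Finset.prod_eq_one fun i hi => by simp [Set.indicator_of_mem (hQ i hi)]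
    rw [hQ1, mul_one]
    have hφ0 : 0 ≤ ∏ i, g (ξ i) := Finset.prod_nonneg fun i _ => hg0 _
    have hφ1 : ∏ i, g (ξ i) ≤ 1 := Finset.prod_le_one (fun i _ => hg0 _) fun i _ => hg1 _
    have hφP : ∏ i, g (ξ i) ≤ P := by
      rw [← Finset.mul_prod_erase Finset.univ _ (Finset.mem_univ (xIdx k))]
      exact mul_le_of_le_one_left hP0 (hg1 _)
    have h1 := abs_deriv_logProfile_le ha hs hχs (hχ.differentiable (by simp)) hL hξ
    have h2 := abs_logProfile_le (a := a) hs hχs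
      (fun τ => (abs_of_nonneg (hχ0 τ)).trans_le (hχ1 τ)) hξ
    rw [abs_of_nonneg (hχ0 _)] at h1
    have h3 := sqrt_gradH2_comp_coord_mul_le (k := k) (ξ := ξ)
      ((contDiff_logProfile (a := a) hs hχs hχ).differentiable (by simp) _)
      ((contDiff_prod_coord hg).differentiable (by simp) ξ)
    rw [abs_of_nonneg hφ0] at h3
    calc _ ≤ _ := h3
      _ ≤ x ^ (a - 1) * (a * χ (s * Real.log x) + s * L * J) * (∏ i, g (ξ i)) +
          x ^ (a - 1) * (s * J) * M := by
        gcongr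
        exact hM ξ
      _ = x ^ (a - 1) * (a * χ (s * Real.log x) * (∏ i, g (ξ i)) +
          (s * L * J * (∏ i, g (ξ i)) + s * M * J)) := by ring
      _ ≤ x ^ (a - 1) * (a * χ (s * Real.log x) * P + (s * L * J * 1 + s * M * J)) := by
        have := mul_nonneg ha (hχ0 (s * Real.log x))
        gcongr
      _ = _ := by ring
  · push Not at hQ
    obtain ⟨i, hi, hξi⟩ := hQ
    have hz : (fun ζ : Heis n => logProfile a s χ (ζ (xIdx k)) * ∏ i, g (ζ i)) =ᶠ[nhds ξ]
        fun _ => 0 := by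
      have hc : Continuous fun ζ : Heis n => ζ i :=
        (EuclideanSpace.proj i : Heis n →L[ℝ] ℝ).continuous
      filter_upwards [hc.continuousAt.preimage_mem_nhds
        (isClosed_Icc.isOpen_compl.mem_nhds hξi)] with ζ hζ
      rw [Finset.prod_eq_zero (Finset.mem_univ i)
        (image_eq_zero_of_notMem_tsupport (f := g) fun h => hζ (hgs h)), mul_zero]
    rw [gradH2_eq_zero_of_eventuallyEq_zero hz, Real.sqrt_zero,
      Finset.prod_eq_zero hi (Set.indicator_of_notMem hξi _), mul_zero, mul_zero, add_zero]
    exact mul_nonneg hx (mul_nonneg (mul_nonneg ha (hχ0 _)) hP0)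

lemma rpow_indicator_one {p : ℝ} (hp : p ≠ 0) (t : Set ℝ) (x : ℝ) :
    t.indicator (1 : ℝ → ℝ) x ^ p = t.indicator 1 x := by
  by_cases hx : x ∈ t <;> simp [hx, Real.zero_rpow hp]

lemma sqrt_gradH2_logProfile_mul_prod_rpow_le {p θ : ℝ} (hp : 1 < p) (hθ : 0 < θ) (hθ' : θ < 1)
    (hs : 0 < s) (hχ : ContDiff ℝ (⊤ : ℕ∞) χ) (hχs : tsupport χ ⊆ Set.Icc (-2) (-1))
    (hχ0 : ∀ τ, 0 ≤ χ τ) (hχ1 : ∀ τ, χ τ ≤ 1) (hL : ∀ τ, |deriv χ τ| ≤ L)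
    (hg : ContDiff ℝ (⊤ : ℕ∞) g) (hgs : tsupport g ⊆ Set.Icc (-2) 2)
    (hg0 : ∀ x, 0 ≤ g x) (hg1 : ∀ x, g x ≤ 1)
    (hM : ∀ ξ : Heis n, √(gradH2 (fun ζ : Heis n => ∏ i, g (ζ i)) ξ) ≤ M)
    {ξ : Heis n} (hξ : 0 < ξ (xIdx k)) :
    √(gradH2 (fun ζ : Heis n => logProfile ((p - 1) / p) s χ (ζ (xIdx k)) * ∏ i, g (ζ i)) ξ) ^ p ≤
      (1 - θ) ^ (1 - p) * ((p - 1) / p) ^ p *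
        ((ξ (xIdx k))⁻¹ * χ (s * Real.log (ξ (xIdx k))) ^ p *
          ∏ i ∈ Finset.univ.erase (xIdx k), g (ξ i) ^ p) +
      θ ^ (1 - p) * (s * (L + M)) ^ p *
        ((ξ (xIdx k))⁻¹ * (Set.Icc (-2 : ℝ) (-1)).indicator 1 (s * Real.log (ξ (xIdx k))) *
            ∏ i ∈ Finset.univ.erase (xIdx k), (Set.Icc (-2 : ℝ) 2).indicator 1 (ξ i)) := by
  have hp0 : 0 < p := by linarith
  have ha : 0 ≤ (p - 1) / p := div_nonneg (by linarith) hp0.le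
  have hL0 : 0 ≤ L := (abs_nonneg _).trans (hL 0)
  have hM0 : 0 ≤ M := (Real.sqrt_nonneg _).trans (hM 0)
  have hpow := Real.rpow_le_rpow (Real.sqrt_nonneg _) (sqrt_gradH2_logProfile_mul_prod_le ha hs hχ
    hχs hχ0 hχ1 hL hg hgs hg0 hg1 hM hξ) hp0.le
  have hJ : ∀ (t : Set ℝ) y, 0 ≤ t.indicator (1 : ℝ → ℝ) y := fun t y =>
    Set.indicator_nonneg (fun _ _ => zero_le_one) _
  have hP0 : 0 ≤ ∏ i ∈ Finset.univ.erase (xIdx k), g (ξ i) := Finset.prod_nonneg fun i _ => hg0 _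
  have hQ0 : 0 ≤ ∏ i ∈ Finset.univ.erase (xIdx k), (Set.Icc (-2 : ℝ) 2).indicator
    (1 : ℝ → ℝ) (ξ i) := Finset.prod_nonneg fun i _ => hJ _ _
  have hA := mul_nonneg ha (hχ0 (s * Real.log (ξ (xIdx k))))
  have hB : 0 ≤ s * (L + M) := by positivity
  have hJQ := mul_nonneg (hJ (Set.Icc (-2) (-1)) (s * Real.log (ξ (xIdx k)))) hQ0
  refine hpow.trans ?_
  have hexp : ((p - 1) / p - 1) * p = -1 := by field_simp; ring
  rw [Real.mul_rpow (Real.rpow_pos_of_pos hξ _).le (add_nonneg (mul_nonneg hA hP0)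
    (mul_nonneg hB hJQ)), ← Real.rpow_mul hξ.le, hexp, Real.rpow_neg_one]
  refine (mul_le_mul_of_nonneg_left (add_rpow_le_weighted hp.le hθ hθ' (mul_nonneg hA hP0)
    (mul_nonneg hB hJQ)) (inv_pos.2 hξ).le).trans_eq ?_
  rw [Real.mul_rpow hA hP0, Real.mul_rpow ha (hχ0 _), Real.mul_rpow hB hJQ,
    Real.mul_rpow (hJ _ _) hQ0, ← Real.finsetProd_rpow _ _ (fun i _ => hg0 _),
    ← Real.finsetProd_rpow _ _ (fun i _ => hJ _ _)]
  simp only [rpow_indicator_one hp0.ne']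
  ring

lemma abs_logProfile_mul_prod_rpow_div {p : ℝ} (hp : 1 < p) (hs : 0 < s)
    (hχs : tsupport χ ⊆ Set.Icc (-2) (-1)) (hχ0 : ∀ τ, 0 ≤ χ τ) (hg0 : ∀ x, 0 ≤ g x)
    (hg1 : ∀ x ∈ Set.Icc (0 : ℝ) 1, g x = 1) {ξ : Heis n} (hξ : 0 < ξ (xIdx k)) :
    |logProfile ((p - 1) / p) s χ (ξ (xIdx k)) * ∏ i, g (ξ i)| ^ p / ξ (xIdx k) ^ p =
      (ξ (xIdx k))⁻¹ * χ (s * Real.log (ξ (xIdx k))) ^ p *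
        ∏ i ∈ Finset.univ.erase (xIdx k), g (ξ i) ^ p := by
  have hp0 : 0 < p := by linarith
  rw [logProfile_of_pos hξ]
  by_cases hm : s * Real.log (ξ (xIdx k)) ∈ Set.Icc (-2 : ℝ) (-1)
  · have hlog : Real.log (ξ (xIdx k)) ≤ 0 := by nlinarith [hm.2]
    have hx1 : ξ (xIdx k) ≤ 1 := (Real.log_nonpos_iff hξ.le).1 hlog
    have hP0 : 0 ≤ ∏ i ∈ Finset.univ.erase (xIdx k), g (ξ i) := Finset.prod_nonneg fun i _ => hg0 _
    have hx := (Real.rpow_pos_of_pos hξ ((p - 1) / p)).le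
    rw [← Finset.mul_prod_erase Finset.univ _ (Finset.mem_univ (xIdx k)), hg1 _ ⟨hξ.le, hx1⟩,
      one_mul, abs_of_nonneg (mul_nonneg (mul_nonneg hx (hχ0 _)) hP0),
      Real.mul_rpow (mul_nonneg hx (hχ0 _)) hP0, Real.mul_rpow hx (hχ0 _), ← Real.rpow_mul hξ.le,
      div_mul_cancel₀ _ hp0.ne', Real.rpow_sub_one hξ.ne', Real.finsetProd_rpow _ _ fun i _ => hg0 _]
    have := (Real.rpow_pos_of_pos hξ p).ne'
    field_simp
  · simp [image_eq_zero_of_notMem_tsupport fun h => hm (hχs h), Real.zero_rpow hp0.ne']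

lemma tsupport_logProfile_mul_subset (hs : 0 < s) (hχs : tsupport χ ⊆ Set.Icc (-2) (-1))
    (φ : Heis n → ℝ) :
    tsupport (fun ζ : Heis n => logProfile a s χ (ζ (xIdx k)) * φ ζ) ⊆
      {ξ : Heis n | 0 < ξ (xIdx k)} := by
  have hc : Continuous fun ζ : Heis n => ζ (xIdx k) :=
    (EuclideanSpace.proj (xIdx k) : Heis n →L[ℝ] ℝ).continuous
  refine (closure_minimal (t := {ξ : Heis n | Real.exp (-2 / s) ≤ ξ (xIdx k)}) (fun ξ hξ => ?_)
    (isClosed_le continuous_const hc)).trans fun ξ hξ => (Real.exp_pos _).trans_le hξ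
  by_contra h
  refine hξ ?_
  change logProfile a s χ (ξ (xIdx k)) * φ ξ = 0
  rw [logProfile_eq_zero_of_lt_exp hs hχs (not_le.1 h), zero_mul]

end TestFunction

lemma ContDiffBump.integrable_and_integral_rpow_pos {c : ℝ} (f : ContDiffBump c) {p : ℝ} (hp : 0 < p) :
    Integrable (fun x => f x ^ p) ∧ 0 < ∫ x, f x ^ p := by
  have hc : Continuous fun x => f x ^ p := f.continuous.rpow_const fun _ => Or.inr hp.le
  refine ⟨hc.integrable_of_hasCompactSupport (f.hasCompactSupport.comp_left
    (g := fun y : ℝ => y ^ p) (Real.zero_rpow hp.ne')), ?_⟩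
  refine hc.integral_pos_of_hasCompactSupport_nonneg_nonzero (f.hasCompactSupport.comp_left
    (g := fun y : ℝ => y ^ p) (Real.zero_rpow hp.ne')) (fun x => Real.rpow_nonneg f.nonneg _)
    (x := c) ?_
  simp [f.one_of_mem_closedBall (Metric.mem_closedBall_self f.rIn_pos.le)]

lemma exists_weights_lt {p c ε I B C : ℝ} (hp : 0 < p) (hε : 0 < ε) (hI : 0 < I) :
    ∃ θ s : ℝ, 0 < θ ∧ θ < 1 ∧ 0 < s ∧
      (1 - θ) ^ (1 - p) * c * I + θ ^ (1 - p) * (s * C) ^ p * B < (c + ε) * I := by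
  have h1 : ContinuousAt (fun θ : ℝ => (1 - θ) ^ (1 - p) * c * I) 0 := by
    refine ((ContinuousAt.rpow_const (by fun_prop) (Or.inl (by norm_num))).mul_const _).mul_const _
  have h1' : ∀ᶠ θ in nhdsWithin (0 : ℝ) (Set.Ioi 0),
      (1 - θ) ^ (1 - p) * c * I < (c + ε) * I :=
    nhdsWithin_le_nhds (h1.eventually_lt_const (by simp; nlinarith))
  obtain ⟨θ, h, hθ⟩ := (h1'.and (Ioo_mem_nhdsGT (zero_lt_one' ℝ))).exists
  have h2 : ContinuousAt (fun s : ℝ =>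
      (1 - θ) ^ (1 - p) * c * I + θ ^ (1 - p) * (s * C) ^ p * B) 0 := by
    have : ContinuousAt (fun s : ℝ => (s * C) ^ p) 0 :=
      ContinuousAt.rpow_const (by fun_prop) (Or.inr hp.le)
    fun_prop
  have h2' : ∀ᶠ s in nhdsWithin (0 : ℝ) (Set.Ioi 0),
      (1 - θ) ^ (1 - p) * c * I + θ ^ (1 - p) * (s * C) ^ p * B < (c + ε) * I :=
    nhdsWithin_le_nhds (h2.eventually_lt_const (by simpa [Real.zero_rpow hp.ne'] using h))
  obtain ⟨s, h', hs⟩ := (h2'.and self_mem_nhdsWithin).exists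
  exact ⟨θ, s, hθ.1, hθ.2, hs, h'⟩

/-- sharpness of the constant `((p−1)/p)^p` in the `L^p` Hardy inequality on
the half-space `Π⁺ = {x₁ > 0}` (i.e. `ν = (1,0,…,0)`, `d = 0`, for which the weight
`Σ_i |⟨X_i,ν⟩|^p + |⟨Y_i,ν⟩|^p = 1` and `dist(ξ, ∂Π⁺) = x₁`). -/
theorem hardy_halfspace_Lp_sharp (n : ℕ) (hn : 1 ≤ n) (p : ℝ) (hp : 2 ≤ p)
    (ε : ℝ) (hε : 0 < ε) :
    ∃ u : Heis n → ℝ, ContDiff ℝ (⊤ : ℕ∞) u ∧ HasCompactSupport u ∧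
      tsupport u ⊆ {ξ : Heis n | 0 < ξ (xIdx (⟨0, hn⟩ : Fin n))} ∧ u ≠ 0 ∧
      ∫ ξ in {ξ : Heis n | 0 < ξ (xIdx (⟨0, hn⟩ : Fin n))}, Real.sqrt (gradH2 u ξ) ^ p <
        (((p - 1) / p) ^ p + ε) * ∫ ξ in {ξ : Heis n | 0 < ξ (xIdx (⟨0, hn⟩ : Fin n))},
          |u ξ| ^ p / (ξ (xIdx (⟨0, hn⟩ : Fin n))) ^ p := by

  have hp1 : 1 < p := by linarith
  have hp0 : 0 < p := by linarith
  set k : Fin n := ⟨0, hn⟩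
  let χ : ContDiffBump (-3 / 2 : ℝ) := ⟨1 / 4, 1 / 2, by norm_num, by norm_num⟩
  let g : ContDiffBump (0 : ℝ) := ⟨1, 2, by norm_num, by norm_num⟩
  have hχs : tsupport χ ⊆ Set.Icc (-2) (-1) := by
    rw [χ.tsupport_eq, Real.closedBall_eq_Icc]
    norm_num [χ]
  have hgs : tsupport g ⊆ Set.Icc (-2) 2 := by
    rw [g.tsupport_eq, Real.closedBall_eq_Icc]
    norm_num [g]
  have hg1 : ∀ x ∈ Set.Icc (0 : ℝ) 1, g x = 1 := fun x hx => by
    refine g.one_of_mem_closedBall ?_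
    rw [Real.closedBall_eq_Icc]
    exact ⟨by linarith [hx.1, show g.rIn = 1 from rfl], by linarith [hx.2, show g.rIn = 1 from rfl]⟩
  have hχd : ContDiff ℝ (⊤ : ℕ∞) χ := χ.contDiff
  have hgd : ContDiff ℝ (⊤ : ℕ∞) g := g.contDiff
  obtain ⟨L, hL⟩ := (χ.hasCompactSupport.deriv).exists_bound_of_continuous
    (hχd.continuous_deriv (by simp))
  obtain ⟨M, hM0, hM⟩ := exists_sqrt_gradH2_le (n := n)
    ((contDiff_prod_coord hgd).of_le (by simp)) (hasCompactSupport_prod_coord g.hasCompactSupport)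
  obtain ⟨hχi, hχI⟩ := χ.integrable_and_integral_rpow_pos hp0
  obtain ⟨hgi, hgI⟩ := g.integrable_and_integral_rpow_pos hp0
  have hJ : ∀ b c : ℝ, Integrable ((Set.Icc b c).indicator (1 : ℝ → ℝ)) := fun b c =>
    (integrable_indicator_iff measurableSet_Icc).2 continuous_one.integrableOn_Icc
  set m := Fintype.card (Fin (2 * n + 1)) - 1
  obtain ⟨θ, s, hθ, hθ', hs, hlt⟩ := exists_weights_lt (c := ((p - 1) / p) ^ p)
    (B := (∫ τ, (Set.Icc (-2 : ℝ) (-1)).indicator 1 τ) *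
      (∫ x, (Set.Icc (-2 : ℝ) 2).indicator 1 x) ^ m)
    (C := L + M) hp0 hε (mul_pos hχI (pow_pos hgI m))
  have hS : MeasurableSet {ξ : Heis n | 0 < ξ (xIdx k)} :=
    measurableSet_coord_pos (xIdx k)
  have hR : ∫ ξ in {ξ : Heis n | 0 < ξ (xIdx k)},
      |logProfile ((p - 1) / p) s χ (ξ (xIdx k)) * ∏ i, g (ξ i)| ^ p / ξ (xIdx k) ^ p =
        1 / s * ((∫ τ, χ τ ^ p) * (∫ x, g x ^ p) ^ m) := by
    rw [setIntegral_congr_fun hS fun ξ hξ => abs_logProfile_mul_prod_rpow_div hp1 hs hχs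
      (fun _ => χ.nonneg) (fun _ => g.nonneg) hg1 hξ, ← mul_assoc,
      ← integral_Ioi_inv_mul_comp_log hs]
    exact setIntegral_mul_prod_erase (xIdx k) (fun x => x⁻¹ * χ (s * Real.log x) ^ p)
      fun x => g x ^ p
  have hi₁ := (integrableOn_mul_prod_erase (xIdx k)
    (integrableOn_Ioi_inv_mul_comp_log hs hχi) hgi).const_mul
      ((1 - θ) ^ (1 - p) * ((p - 1) / p) ^ p)
  have hi₂ := (integrableOn_mul_prod_erase (xIdx k)
    (integrableOn_Ioi_inv_mul_comp_log hs (hJ (-2) (-1))) (hJ (-2) 2)).const_mul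
      (θ ^ (1 - p) * (s * (L + M)) ^ p)
  have hLHS : ∫ ξ in {ξ : Heis n | 0 < ξ (xIdx k)}, √(gradH2 (fun ζ : Heis n =>
      logProfile ((p - 1) / p) s χ (ζ (xIdx k)) * ∏ i, g (ζ i)) ξ) ^ p ≤ _ :=
    integral_mono_of_nonneg (Filter.Eventually.of_forall fun ξ => by positivity) (hi₁.add hi₂)
      ((ae_restrict_iff' hS).2 (Filter.Eventually.of_forall fun ξ hξ =>
        sqrt_gradH2_logProfile_mul_prod_rpow_le hp1 hθ hθ' hs hχd hχs (fun _ => χ.nonneg)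
          (fun _ => χ.le_one) hL hgd hgs (fun _ => g.nonneg) (fun _ => g.le_one) hM hξ))
  simp only [Pi.add_apply] at hLHS
  rw [integral_add hi₁ hi₂, integral_const_mul, integral_const_mul,
    setIntegral_mul_prod_erase (xIdx k) (fun x => x⁻¹ * χ (s * Real.log x) ^ p) fun x => g x ^ p,
    setIntegral_mul_prod_erase (xIdx k)
      (fun x => x⁻¹ * (Set.Icc (-2 : ℝ) (-1)).indicator 1 (s * Real.log x)),
    integral_Ioi_inv_mul_comp_log hs fun τ => χ τ ^ p,
    integral_Ioi_inv_mul_comp_log hs] at hLHS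
  refine ⟨fun ζ => logProfile ((p - 1) / p) s χ (ζ (xIdx k)) * ∏ i, g (ζ i), ?_, ?_,
    tsupport_logProfile_mul_subset hs hχs _, fun h => ?_, ?_⟩
  · exact ((contDiff_logProfile hs hχs hχd).comp
      (EuclideanSpace.proj (xIdx k) : Heis n →L[ℝ] ℝ).contDiff).mul (contDiff_prod_coord hgd)
  · exact (hasCompactSupport_prod_coord g.hasCompactSupport).mul_left
  · have h0 : ∀ ξ : Heis n, logProfile ((p - 1) / p) s χ (ξ (xIdx k)) * ∏ i, g (ξ i) = 0 :=
      fun ξ => congrFun h ξ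
    simp only [h0, abs_zero, Real.zero_rpow hp0.ne', zero_div, integral_zero] at hR
    have : 0 < 1 / s * ((∫ τ, χ τ ^ p) * (∫ x, g x ^ p) ^ m) := by positivity
    linarith
  · rw [hR]
    refine hLHS.trans_lt ?_
    have := mul_lt_mul_of_pos_left hlt (one_div_pos.2 hs)
    calc _ = _ := ?_
      _ < _ := this
      _ = _ := by ring
    ring
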